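/- arXiv:1609.08204 — 2 statements merged into one kernel-verified Lean document; each statement's English description precedes it below -/
import Mathlib

section
/- Let β ≠ 0, α ∈ ℝ, c ≥ 0, suppose there exists a CIUPM for T_{α,β} whose support has diameter equal to c, and let c̃ > c. Then for every CIUPM μ for T_{α,β} with diam(supp μ) = c̃, there exists another CIUPM ν for T_{α,β} with diam(supp ν) = c̃ such that ν is not a translate of μ, i.e., ν ≠ μ ∘ T_{γ,1}^{-1} for every γ ∈ ℝ. -/
open MeasureTheory Set

/-- The linear transformation `T_{α,β}(x) = βx + α`. -/
def T (α β : ℝ) : ℝ → ℝ := fun x => β * x + α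

/-- A probability measure `μ` on `ℝ` is a CIUPM for a map `S : ℝ → ℝ` if the pushforwards
of `μ` and of `μ ∘ S⁻¹` under the fractional-part map both equal Lebesgue measure
restricted to `[0,1)`. -/
def IsCIUPM (S : ℝ → ℝ) (μ : Measure ℝ) : Prop :=
  μ.map Int.fract = volume.restrict (Ico (0 : ℝ) 1) ∧
    (μ.map S).map Int.fract = volume.restrict (Ico (0 : ℝ) 1)

/-- The topological support of a measure on `ℝ`: the set of points all of whose
neighbourhoods have positive measure (the smallest closed set of full measure). -/
def msupp (μ : Measure ℝ) : Set ℝ := {x : ℝ | ∀ U ∈ nhds x, 0 < μ U}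

lemma measurable_T (α β : ℝ) : Measurable (T α β) := by
  unfold T; fun_prop

/-- Lebesgue measure on any unit interval projects to Lebesgue measure on `[0,1)`. -/
lemma map_fract_restrict_Ico (γ : ℝ) :
    (volume.restrict (Ico γ (γ + 1))).map Int.fract = volume.restrict (Ico (0 : ℝ) 1) := by
  have hg : Measurable fun x : UnitAddCircle => ((AddCircle.measurableEquivIco 1 0 x : _) : ℝ) :=
    measurable_subtype_coe.comp (AddCircle.measurableEquivIco 1 0).measurable
  have hfract : (Int.fract : ℝ → ℝ) =
      (fun x : UnitAddCircle => ((AddCircle.measurableEquivIco 1 0 x : _) : ℝ)) ∘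
        fun x : ℝ => (x : UnitAddCircle) := by
    funext x
    have := AddCircle.coe_equivIco_mk_apply (p := (1 : ℝ)) x
    simp only [div_one, mul_one] at this
    exact this.symm
  have key (a : ℝ) : (volume.restrict (Ico a (a + 1))).map Int.fract =
      (volume : Measure UnitAddCircle).map
        fun x : UnitAddCircle => ((AddCircle.measurableEquivIco 1 0 x : _) : ℝ) := by
    have hmk := UnitAddCircle.measurePreserving_mk a
    rw [restrict_Ico_eq_restrict_Ioc, hfract, ← Measure.map_map hg hmk.measurable, hmk.map_eq]
  have h0 : (volume.restrict (Ico (0 : ℝ) 1)).map Int.fract = volume.restrict (Ico (0 : ℝ) 1) := by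
    have : (Int.fract : ℝ → ℝ) =ᵐ[volume.restrict (Ico (0 : ℝ) 1)] id := by
      filter_upwards [ae_restrict_mem measurableSet_Ico] with x hx
      exact Int.fract_eq_self.2 hx
    rw [Measure.map_congr this, Measure.map_id]
  rw [key γ, ← key 0, zero_add (1 : ℝ), h0]

lemma map_fract_map_add_const {μ : Measure ℝ} (γ : ℝ)
    (h : μ.map Int.fract = volume.restrict (Ico (0 : ℝ) 1)) :
    (μ.map (· + γ)).map Int.fract = volume.restrict (Ico (0 : ℝ) 1) := by
  have hadd : Measurable fun x : ℝ => x + γ := by fun_prop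
  have hfr : Measurable (Int.fract : ℝ → ℝ) := measurable_fract
  have hcomp : (Int.fract ∘ fun x : ℝ => x + γ) =
      (Int.fract ∘ fun x : ℝ => x + γ) ∘ Int.fract := by
    funext x
    simp only [Function.comp_apply, Int.fract_eq_fract]
    exact ⟨⌊x⌋, by rw [Int.fract]; ring⟩
  have hshift : (volume.restrict (Ico (0 : ℝ) 1)).map (· + γ) =
      volume.restrict (Ico γ (γ + 1)) := by
    have := (measurePreserving_add_right (volume : Measure ℝ) γ).restrict_preimage
      (measurableSet_Ico (a := γ) (b := γ + 1))
    rw [← this.map_eq]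
    congr 2
    ext x
    simp [add_comm]
  rw [Measure.map_map hfr hadd, hcomp, ← Measure.map_map (hfr.comp hadd) hfr, h,
    ← Measure.map_map hfr hadd, hshift, map_fract_restrict_Ico]

lemma T_one_eq (γ : ℝ) : T γ 1 = (· + γ) := by
  funext x; simp [T]

lemma IsCIUPM.map_translate {α β : ℝ} {μ : Measure ℝ} (h : IsCIUPM (T α β) μ) (γ : ℝ) :
    IsCIUPM (T α β) (μ.map (T γ 1)) := by
  refine ⟨?_, ?_⟩
  · rw [T_one_eq]
    exact map_fract_map_add_const γ h.1
  · have hcomp : T α β ∘ T γ 1 = (· + β * γ) ∘ T α β := by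
      funext x; simp only [T, Function.comp_apply]; ring
    rw [Measure.map_map (measurable_T _ _) (measurable_T _ _), hcomp,
      ← Measure.map_map (by fun_prop) (measurable_T _ _)]
    exact map_fract_map_add_const _ h.2

lemma msupp_map_translate (μ : Measure ℝ) (γ : ℝ) :
    msupp (μ.map (T γ 1)) = (· + γ) '' msupp μ := by
  have hmap (U : Set ℝ) : μ.map (T γ 1) U = μ ((· + γ) ⁻¹' U) := by
    rw [T_one_eq]
    exact (MeasurableEquiv.addRight γ).map_apply U
  ext x
  simp only [msupp, mem_ofPred_eq, hmap, image_add_right, mem_preimage]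
  constructor
  · intro h U hU
    have := h ((· + -γ) ⁻¹' U) ((continuous_add_const (-γ)).continuousAt hU)
    simpa [preimage_preimage] using this
  · intro h U hU
    refine h _ ((continuous_add_const γ).continuousAt ?_)
    simpa using hU

lemma msupp_smul_add (μ₁ μ₂ : Measure ℝ) {a : ENNReal} (ha : a ≠ 0) :
    msupp (a • μ₁ + a • μ₂) = msupp μ₁ ∪ msupp μ₂ := by
  ext x
  simp only [msupp, mem_ofPred_eq, mem_union, Measure.add_apply, Measure.smul_apply, smul_eq_mul]
  constructor
  · intro h
    by_contra! hn
    obtain ⟨⟨U, hU, hU0⟩, V, hV, hV0⟩ := hn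
    have h1 : μ₁ (U ∩ V) = 0 := measure_mono_null inter_subset_left (nonpos_iff_eq_zero.1 hU0)
    have h2 : μ₂ (U ∩ V) = 0 := measure_mono_null inter_subset_right (nonpos_iff_eq_zero.1 hV0)
    simpa [h1, h2] using h _ (Filter.inter_mem hU hV)
  · rintro (h | h) U hU
    · exact (ENNReal.mul_pos ha (h U hU).ne').trans_le le_self_add
    · exact (ENNReal.mul_pos ha (h U hU).ne').trans_le le_add_self

lemma half_smul_add_half_smul {X : Type*} [MeasurableSpace X] (μ : Measure X) :
    (2⁻¹ : ENNReal) • μ + (2⁻¹ : ENNReal) • μ = μ := by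
  rw [← add_smul, ENNReal.inv_two_add_inv_two, one_smul]

lemma IsCIUPM.midpoint {α β : ℝ} {μ₁ μ₂ : Measure ℝ} (h₁ : IsCIUPM (T α β) μ₁)
    (h₂ : IsCIUPM (T α β) μ₂) :
    IsCIUPM (T α β) ((2⁻¹ : ENNReal) • μ₁ + (2⁻¹ : ENNReal) • μ₂) := by
  have hfr : Measurable (Int.fract : ℝ → ℝ) := measurable_fract
  refine ⟨?_, ?_⟩
  · rw [Measure.map_add _ _ hfr, Measure.map_smul, Measure.map_smul, h₁.1, h₂.1,
      half_smul_add_half_smul]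
  · rw [Measure.map_add _ _ (measurable_T α β), Measure.map_smul, Measure.map_smul,
      Measure.map_add _ _ hfr, Measure.map_smul, Measure.map_smul, h₁.2, h₂.2,
      half_smul_add_half_smul]

lemma eq_of_half_smul_add_half_smul_eq {X : Type*} [MeasurableSpace X] {μ ν : Measure X}
    [IsFiniteMeasure μ]
    (h : (2⁻¹ : ENNReal) • μ + (2⁻¹ : ENNReal) • ν = μ) : ν = μ := by
  ext s hs
  have hs' := congrArg (fun m : Measure X => m s) (h.trans (half_smul_add_half_smul μ).symm)
  simp only [Measure.add_apply, Measure.smul_apply, smul_eq_mul] at hs'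
  have hfin : (2⁻¹ : ENNReal) * μ s ≠ ⊤ := ENNReal.mul_ne_top (by simp) (measure_ne_top μ s)
  have := (ENNReal.add_right_inj hfin).1 hs'
  exact (ENNReal.mul_right_inj (by simp) (by simp)).1 this

/-- A set of real numbers of finite diameter can be translated into the convex hull of any
set of larger diameter, matching the infima. -/
lemma exists_translate_image_subset_Icc {A B : Set ℝ} (hA : Bornology.IsBounded A)
    (hAB : sSup A - sInf A ≤ sSup B - sInf B) :
    (· + (sInf B - sInf A)) '' A ⊆ Icc (sInf B) (sSup B) := by
  rintro _ ⟨x, hx, rfl⟩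
  have h1 := csInf_le hA.bddBelow hx
  have h2 := le_csSup hA.bddAbove hx
  constructor <;> dsimp only <;> linarith

theorem stmt_9 (α β c c' : ℝ) (hβ : β ≠ 0) (hc : 0 ≤ c) (hcc' : c < c')
    (h : ∃ μ : Measure ℝ, IsProbabilityMeasure μ ∧ IsCIUPM (T α β) μ ∧
      EMetric.diam (msupp μ) = ENNReal.ofReal c) :
    ∀ μ : Measure ℝ, IsProbabilityMeasure μ → IsCIUPM (T α β) μ →
      EMetric.diam (msupp μ) = ENNReal.ofReal c' →
      ∃ ν : Measure ℝ, IsProbabilityMeasure ν ∧ IsCIUPM (T α β) ν ∧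
        EMetric.diam (msupp ν) = ENNReal.ofReal c' ∧
        ∀ γ : ℝ, ν ≠ μ.map (T γ 1) := by
  obtain ⟨μ₀, hμ₀, hC₀, hd₀⟩ := h
  intro μ hμ hC hd
  have hc' : 0 < c' := hc.trans_lt hcc'
  have hA : Bornology.IsBounded (msupp μ₀) :=
    Metric.isBounded_iff_ediam_ne_top.2 (ne_of_eq_of_ne hd₀ ENNReal.ofReal_ne_top)
  have hB : Bornology.IsBounded (msupp μ) :=
    Metric.isBounded_iff_ediam_ne_top.2 (ne_of_eq_of_ne hd ENNReal.ofReal_ne_top)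
  have hBne : (msupp μ).Nonempty := by
    rw [nonempty_iff_ne_empty]
    intro he
    have : ENNReal.ofReal c' = 0 := hd.symm.trans (he ▸ Metric.ediam_empty)
    exact absurd (ENNReal.ofReal_eq_zero.1 this) hc'.not_ge
  have hlen₀ : sSup (msupp μ₀) - sInf (msupp μ₀) ≤ c :=
    (ENNReal.ofReal_le_ofReal_iff hc).1 ((Real.ediam_eq hA).symm.trans hd₀).le
  have hlen : c' ≤ sSup (msupp μ) - sInf (msupp μ) :=
    (ENNReal.ofReal_le_ofReal_iff'.1 ((Real.ediam_eq hB).symm.trans hd).ge).resolve_right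
      hc'.not_ge
  set δ := sInf (msupp μ) - sInf (msupp μ₀)
  set μ₁ := μ₀.map (T δ 1) with hμ₁
  have hsub : msupp μ₁ ⊆ Icc (sInf (msupp μ)) (sSup (msupp μ)) := by
    rw [hμ₁, msupp_map_translate]
    exact exists_translate_image_subset_Icc hA (by linarith)
  have hp₁ : IsProbabilityMeasure μ₁ :=
    Measure.isProbabilityMeasure_map (measurable_T δ 1).aemeasurable
  have hsupp : msupp ((2⁻¹ : ENNReal) • μ + (2⁻¹ : ENNReal) • μ₁) = msupp μ ∪ msupp μ₁ :=
    msupp_smul_add μ μ₁ (by simp)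
  have hunion : msupp μ ∪ msupp μ₁ ⊆ Icc (sInf (msupp μ)) (sSup (msupp μ)) :=
    union_subset (fun x hx => ⟨csInf_le hB.bddBelow hx, le_csSup hB.bddAbove hx⟩) hsub
  refine ⟨(2⁻¹ : ENNReal) • μ + (2⁻¹ : ENNReal) • μ₁, ⟨?_⟩, hC.midpoint (hC₀.map_translate δ),
    ?_, ?_⟩
  · simp [ENNReal.inv_two_add_inv_two]
  · rw [hsupp]
    apply le_antisymm
    · refine (Metric.ediam_mono hunion).trans ?_
      rw [Real.ediam_Icc, ← Real.ediam_eq hB]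
      exact hd.le
    · exact hd.ge.trans (Metric.ediam_mono subset_union_left)
  · intro γ hγ
    have hinf : sInf (msupp μ ∪ msupp μ₁) = sInf (msupp μ) :=
      le_antisymm (csInf_le_csInf (bddBelow_Icc.mono hunion) hBne subset_union_left)
        (le_csInf (hBne.mono subset_union_left) fun x hx => (hunion hx).1)
    have hinf' : sInf ((· + γ) '' msupp μ) = sInf (msupp μ) + γ :=
      ((OrderIso.addRight γ).map_csInf' hBne hB.bddBelow).symm
    have hγ0 : γ = 0 := by
      have := congrArg (fun m => sInf (msupp m)) hγ
      simp only [hsupp, msupp_map_translate, hinf, hinf'] at this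
      linarith
    have hid : μ.map (T γ 1) = μ := by
      rw [T_one_eq, hγ0]
      simp
    have heq : μ₁ = μ := eq_of_half_smul_add_half_smul_eq (hγ.trans hid)
    have hdiam : Metric.ediam (msupp μ₁) = ENNReal.ofReal c := by
      rw [hμ₁, msupp_map_translate]
      exact ((isometry_add_right δ).ediam_image _).trans hd₀
    rw [heq] at hdiam
    exact hcc'.ne' ((ENNReal.ofReal_eq_ofReal_iff hc'.le hc).1 (hd.symm.trans hdiam))
end

section
/- Let β > 1 be irrational. If μ is a CIUPM for T_{0,β} with supp μ ⊆ [0, 1 + 1/β] and diam(supp μ) = 1 + 1/β, then μ equals the measure with Lebesgue density ρ_β(t) = βt for t ∈ [0, 1/β), ρ_β(t) = 1 for t ∈ [1/β, 1), ρ_β(t) = −βt + 1 + β for t ∈ [1, 1 + 1/β], and ρ_β(t) = 0 elsewhere; equivalently, its distribution function is F_μ(t) = (β/2)t² on [0, 1/β], F_μ(t) = t − 1/(2β) on [1/β, 1], and F_μ(t) = −(β/2)(t−1)² + t − 1/(2β) on [1, 1 + 1/β]. -/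
open MeasureTheory Set

/-- The density `ρ_β(t) = βt` on `[0,1/β)`, `1` on `[1/β,1)`, `−βt + 1 + β` on
`[1, 1 + 1/β]`, and `0` elsewhere. -/
noncomputable def rho (β : ℝ) : ℝ → ℝ := fun t =>
  if t < 0 then 0
  else if t < 1 / β then β * t
  else if t < 1 then 1
  else if t ≤ 1 + 1 / β then -β * t + 1 + β
  else 0

open BoundedContinuousFunction in
theorem AddCircle.measure_ext_of_integral_fourier {p : ℝ} [Fact (0 < p)]
    {m₁ m₂ : Measure (AddCircle p)} [IsFiniteMeasure m₁] [IsFiniteMeasure m₂]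
    (h : ∀ n : ℤ, ∫ x, fourier n x ∂m₁ = ∫ x, fourier n x ∂m₂) : m₁ = m₂ := by
  refine ext_of_forall_mem_subalgebra_integral_eq_of_polish (𝕜 := ℂ)
    (A := (fourierSubalgebra (T := p)).comap (toContinuousMapStarₐ ℂ)) ?_ ?_
  · intro x y hxy
    obtain ⟨_, ⟨f, hf, rfl⟩, hne⟩ := fourierSubalgebra_separatesPoints (T := p) hxy
    exact ⟨_, ⟨_, ⟨mkOfCompact f, hf, rfl⟩, rfl⟩, hne⟩
  · intro g hg
    have hint (m : Measure (AddCircle p)) [IsFiniteMeasure m] (f : C(AddCircle p, ℂ)) :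
        Integrable f m := (mkOfCompact f).integrable m
    have key (f : C(AddCircle p, ℂ)) (hf : f ∈ Submodule.span ℂ (range (fourier (T := p)))) :
        ∫ x, f x ∂m₁ = ∫ x, f x ∂m₂ := by
      induction hf using Submodule.span_induction with
      | mem f hf => obtain ⟨n, rfl⟩ := hf; exact h n
      | zero => simp
      | add f g _ _ hf hg =>
        simp only [ContinuousMap.add_apply]
        rw [integral_add (hint _ f) (hint _ g), integral_add (hint _ f) (hint _ g), hf, hg]
      | smul a f _ hf =>
        simp only [ContinuousMap.smul_apply]
        rw [integral_smul, integral_smul, hf]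
    refine key (toContinuousMapStarₐ ℂ g) ?_
    rw [← fourierSubalgebra_coe]
    exact hg

/-- Finite measures on `[0, p)` with the same Fourier coefficients are equal. -/
theorem measure_ext_of_integral_exp {p : ℝ} (hp : 0 < p) {m₁ m₂ : Measure ℝ}
    [IsFiniteMeasure m₁] [IsFiniteMeasure m₂]
    (h₁ : ∀ᵐ x ∂m₁, x ∈ Ico 0 p) (h₂ : ∀ᵐ x ∂m₂, x ∈ Ico 0 p)
    (h : ∀ n : ℤ, ∫ x : ℝ, Complex.exp (2 * Real.pi * Complex.I * n * x / p) ∂m₁ =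
      ∫ x : ℝ, Complex.exp (2 * Real.pi * Complex.I * n * x / p) ∂m₂) : m₁ = m₂ := by
  have : Fact (0 < p) := ⟨hp⟩
  have hmk : Measurable ((↑) : ℝ → AddCircle p) := AddCircle.measurable_mk'
  have hcircle : m₁.map ((↑) : ℝ → AddCircle p) = m₂.map ((↑) : ℝ → AddCircle p) := by
    refine AddCircle.measure_ext_of_integral_fourier fun n => ?_
    rw [integral_map hmk.aemeasurable (fourier n).continuous.aestronglyMeasurable,
      integral_map hmk.aemeasurable (fourier n).continuous.aestronglyMeasurable]
    simpa only [fourier_coe_apply] using h n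
  let r : AddCircle p → ℝ := fun y => AddCircle.measurableEquivIco p 0 y
  have hr : Measurable r := measurable_subtype_coe.comp (AddCircle.measurableEquivIco p 0).measurable
  have hback (m : Measure ℝ) (hm : ∀ᵐ x ∂m, x ∈ Ico 0 p) :
      (m.map ((↑) : ℝ → AddCircle p)).map r = m := by
    rw [Measure.map_map hr hmk]
    conv_rhs => rw [← Measure.map_id (μ := m)]
    refine Measure.map_congr ?_
    filter_upwards [hm] with x hx
    exact AddCircle.equivIco_coe_of_mem (by simpa using hx)
  rw [← hback m₁ h₁, ← hback m₂ h₂, hcircle]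

section FractUniform

variable {μ : Measure ℝ}

/-- A measure which is uniform modulo one has no atoms. -/
theorem measure_singleton_of_map_fract (h : μ.map Int.fract = volume.restrict (Ico (0 : ℝ) 1))
    (x : ℝ) : μ {x} = 0 := by
  have h1 : μ (Int.fract ⁻¹' {Int.fract x}) = 0 := by
    rw [← Measure.map_apply measurable_fract (measurableSet_singleton _), h]
    exact le_antisymm ((Measure.restrict_apply_le _ _).trans (by simp)) zero_le
  exact measure_mono_null (by simp) h1

/-- The part of `μ` on `[0, 1)` and its part on `[1, 2)` shifted back add up to length. -/
theorem measure_add_measure_shift (h : μ.map Int.fract = volume.restrict (Ico (0 : ℝ) 1))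
    (hμ : ∀ᵐ x ∂μ, x ∈ Ico (0 : ℝ) 2) {A : Set ℝ} (hA : MeasurableSet A)
    (hA1 : A ⊆ Ico 0 1) : μ A + μ ((fun x => x - 1) ⁻¹' A) = volume A := by
  have hA' : MeasurableSet ((fun x : ℝ => x - 1) ⁻¹' A) := (measurable_id.sub_const 1) hA
  have hvol : volume A = μ (Int.fract ⁻¹' A) := by
    rw [← Measure.map_apply measurable_fract hA, h, Measure.restrict_apply hA,
      inter_eq_left.2 hA1]
  rw [hvol, ← measure_union _ hA']
  · refine measure_congr ?_
    filter_upwards [hμ] with x hx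
    refine propext (?_ : x ∈ A ∪ (fun x => x - 1) ⁻¹' A ↔ x ∈ Int.fract ⁻¹' A)
    simp only [mem_union, mem_preimage]
    rcases lt_or_ge x 1 with hx1 | hx1
    · rw [Int.fract_eq_self.2 ⟨hx.1, hx1⟩, or_iff_left]
      exact fun hxA => by linarith [(hA1 hxA).1]
    · have : Int.fract x = x - 1 := by
        rw [← Int.fract_sub_one, Int.fract_eq_self.2 ⟨by linarith, by linarith [hx.2]⟩]
      rw [this, or_iff_right]
      exact fun hxA => by linarith [(hA1 hxA).2]
  · rw [Set.disjoint_left]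
    intro x hx hx'
    linarith [(hA1 hx).2, (hA1 hx').1]

end FractUniform

theorem ae_mem_of_msupp_subset {μ : Measure ℝ} {K : Set ℝ} (hK : msupp μ ⊆ K) :
    ∀ᵐ x ∂μ, x ∈ K := by
  have : msupp μ = μ.support := by
    ext x
    rw [Measure.mem_support_iff_forall]
    rfl
  filter_upwards [Measure.support_mem_ae (μ := μ)] with x hx
  exact hK (this ▸ hx)

/-- The nontrivial Fourier coefficients of a measure that is uniform modulo one after scaling. -/
theorem integral_exp_eq_zero_of_map_fract {μ : Measure ℝ} {β : ℝ}
    (h : (μ.map (T 0 β)).map Int.fract = volume.restrict (Ico (0 : ℝ) 1)) {n : ℤ} (hn : n ≠ 0) :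
    ∫ x : ℝ, Complex.exp (2 * Real.pi * Complex.I * n * β * x) ∂μ = 0 := by
  let g : ℝ → ℂ := fun y => Complex.exp (2 * Real.pi * Complex.I * n * y)
  have hg : Continuous g := by fun_prop
  have hgf (y : ℝ) : g (Int.fract y) = g y := by
    refine Complex.exp_eq_exp_iff_exists_int.2 ⟨-(n * ⌊y⌋), ?_⟩
    rw [Int.fract]
    push_cast
    ring
  have hT : Measurable (T 0 β) := by unfold T; fun_prop
  have hc : 2 * Real.pi * Complex.I * n ≠ 0 := by
    simp [Real.pi_ne_zero, hn]
  calc ∫ x : ℝ, Complex.exp (2 * Real.pi * Complex.I * n * β * x) ∂μ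
      = ∫ x, g (Int.fract (T 0 β x)) ∂μ := by
        refine integral_congr_ae (.of_forall fun x => ?_)
        simp only [hgf, T, g]
        congr 1
        push_cast
        ring
    _ = ∫ y, g y ∂((μ.map (T 0 β)).map Int.fract) := by
        rw [Measure.map_map measurable_fract hT,
          integral_map (measurable_fract.comp hT).aemeasurable hg.aestronglyMeasurable]
        rfl
    _ = ∫ y in (0 : ℝ)..1, g y := by
        rw [h, intervalIntegral.integral_of_le zero_le_one, integral_Ico_eq_integral_Ioc]
    _ = 0 := by
        rw [integral_exp_mul_complex hc]
        have : Complex.exp (2 * Real.pi * Complex.I * n) = 1 := by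
          rw [Complex.exp_eq_one_iff]
          exact ⟨n, by ring⟩
        simp [this]

/-- The Fourier coefficients of `x ↦ x` over a full period `[0, γ]`. -/
theorem integral_mul_exp_of_exp_eq_one {c : ℂ} (hc : c ≠ 0) {γ : ℝ}
    (hγ : Complex.exp (c * γ) = 1) : ∫ x in (0 : ℝ)..γ, (x : ℂ) * Complex.exp (c * x) = γ / c := by
  have D (x : ℝ) : HasDerivAt
      (fun y : ℝ => y * Complex.exp (c * y) / c - Complex.exp (c * y) / c ^ 2)
      (x * Complex.exp (c * x)) x := by
    have h1 : HasDerivAt (fun y : ℂ => y * Complex.exp (c * y) / c - Complex.exp (c * y) / c ^ 2)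
        (x * Complex.exp (c * x)) x := by
      have h2 : HasDerivAt (fun y : ℂ => Complex.exp (c * y)) (Complex.exp (c * x) * (c * 1)) x :=
        ((hasDerivAt_id _).const_mul c).cexp
      refine ((((hasDerivAt_id _).mul h2).div_const c).sub (h2.div_const (c ^ 2))).congr_deriv ?_
      simp only [id]
      field_simp
      ring
    exact h1.comp_ofReal
  rw [intervalIntegral.integral_eq_sub_of_hasDerivAt (fun x _ => D x)
    (Continuous.intervalIntegrable (by fun_prop) _ _), hγ]
  simp

/-- The measure with density `βx` on `[0, γ)`. -/
noncomputable def rampMeasure (β γ : ℝ) : Measure ℝ :=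
  (volume.restrict (Ico 0 γ)).withDensity fun x => ENNReal.ofReal (β * x)

section Ramp

variable {β γ : ℝ}

theorem rampMeasure_Ico (hβ : 0 < β) {a b : ℝ} (ha : 0 ≤ a) (hab : a ≤ b) (hb : b ≤ γ) :
    rampMeasure β γ (Ico a b) = ENNReal.ofReal (β * (b ^ 2 - a ^ 2) / 2) := by
  have hsub : Ico a b ∩ Ico 0 γ = Ico a b := inter_eq_left.2 (Ico_subset_Ico ha hb)
  have hc : Continuous fun x : ℝ => β * x := by fun_prop
  rw [rampMeasure, withDensity_apply _ measurableSet_Ico,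
    Measure.restrict_restrict measurableSet_Ico, hsub,
    ← ofReal_integral_eq_lintegral_ofReal]
  · rw [integral_Ico_eq_integral_Ioc, ← intervalIntegral.integral_of_le hab,
      intervalIntegral.integral_const_mul, integral_id]
    ring_nf
  · exact (hc.integrableOn_Icc (a := a) (b := b)).mono_set Ico_subset_Icc_self
  · filter_upwards [ae_restrict_mem measurableSet_Ico] with x hx
    exact mul_nonneg hβ.le (ha.trans hx.1)

theorem ae_mem_rampMeasure : ∀ᵐ x ∂rampMeasure β γ, x ∈ Ico 0 γ :=
  (withDensity_absolutelyContinuous _ _).ae_le (ae_restrict_mem measurableSet_Ico)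

theorem rampMeasure_univ (hβ : 0 < β) (hγ : 0 ≤ γ) :
    rampMeasure β γ univ = ENNReal.ofReal (β * γ ^ 2 / 2) := by
  rw [← Measure.restrict_eq_self_of_ae_mem (ae_mem_rampMeasure (β := β) (γ := γ)),
    Measure.restrict_apply_univ, rampMeasure_Ico hβ le_rfl hγ le_rfl]
  ring_nf

theorem integral_exp_rampMeasure (hβ : 0 < β) (hγ : 0 ≤ γ) {c : ℂ} (hc : c ≠ 0)
    (hcγ : Complex.exp (c * γ) = 1) :
    ∫ x : ℝ, Complex.exp (c * x) ∂rampMeasure β γ = β * γ / c := by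
  rw [rampMeasure, integral_withDensity_eq_integral_toReal_smul (by fun_prop) (by simp)]
  calc ∫ x in Ico 0 γ, (ENNReal.ofReal (β * x)).toReal • Complex.exp (c * x)
      = ∫ x in Ico 0 γ, (β : ℂ) * (x * Complex.exp (c * x)) := by
        refine setIntegral_congr_fun measurableSet_Ico fun x hx => ?_
        rw [ENNReal.toReal_ofReal (mul_nonneg hβ.le hx.1), Complex.real_smul]
        push_cast
        ring
    _ = β * γ / c := by
        rw [integral_const_mul, integral_Ico_eq_integral_Ioc,
          ← intervalIntegral.integral_of_le hγ, integral_mul_exp_of_exp_eq_one hc hcγ]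
        ring

end Ramp

section Uniqueness

variable {μ : Measure ℝ} {β γ : ℝ}

theorem restrict_add_map_restrict (h : μ.map Int.fract = volume.restrict (Ico (0 : ℝ) 1))
    (hμ : ∀ᵐ x ∂μ, x ∈ Ico (0 : ℝ) 2) (hγ : γ ≤ 1) :
    μ.restrict (Ico 0 γ) + (μ.restrict (Ico 1 (1 + γ))).map (fun x => x - 1) =
      volume.restrict (Ico 0 γ) := by
  have hm : Measurable fun x : ℝ => x - 1 := measurable_id.sub_const 1
  ext A hA
  rw [Measure.add_apply, Measure.map_apply hm hA, Measure.restrict_apply hA,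
    Measure.restrict_apply hA, Measure.restrict_apply (hm hA),
    ← measure_add_measure_shift h hμ (hA.inter measurableSet_Ico)
      (inter_subset_right.trans (Ico_subset_Ico_right hγ)), preimage_inter]
  congr 3
  ext x
  simp only [mem_Ico, mem_preimage]
  constructor <;> rintro ⟨_, _⟩ <;> constructor <;> linarith

theorem restrict_Ico_eq_volume (h : μ.map Int.fract = volume.restrict (Ico (0 : ℝ) 1))
    (hγ0 : 0 < γ) (hγ : γ < 1) (hμ : ∀ᵐ x ∂μ, x ∈ Ico (0 : ℝ) (1 + γ)) :
    μ.restrict (Ico γ 1) = volume.restrict (Ico γ 1) := by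
  ext A hA
  have hzero : μ ((fun x => x - 1) ⁻¹' (A ∩ Ico γ 1)) = 0 := by
    refine measure_mono_null ?_ (ae_iff.1 hμ)
    rintro x ⟨_, hx⟩ hx'
    linarith [hx.1, hx'.2]
  rw [Measure.restrict_apply hA, Measure.restrict_apply hA,
    ← measure_add_measure_shift h (hμ.mono fun x hx => ⟨hx.1, by linarith [hx.2]⟩)
      (hA.inter measurableSet_Ico) (inter_subset_right.trans (Ico_subset_Ico_left hγ0.le)),
    hzero, add_zero]

theorem exp_frequency_ne_one (hirr : Irrational β) {n : ℤ} (hn : n ≠ 0) :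
    Complex.exp (2 * Real.pi * Complex.I * n * β) ≠ 1 := by
  intro he
  obtain ⟨k, hk⟩ := Complex.exp_eq_one_iff.1 he
  have h1 : (n : ℂ) * β = k := by
    refine mul_left_cancel₀ Complex.two_pi_I_ne_zero ?_
    rw [mul_comm _ (k : ℂ), ← hk]
    ring
  exact (hirr.intCast_mul hn).ne_int k (by exact_mod_cast h1)

theorem integrable_exp_frequency (m : Measure ℝ) [IsFiniteMeasure m] (n : ℤ) :
    Integrable (fun x : ℝ => Complex.exp (2 * Real.pi * Complex.I * n * β * x)) m := by
  refine Integrable.of_bound (by fun_prop) 1 (.of_forall fun x => le_of_eq ?_)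
  rw [← Complex.norm_exp_ofReal_mul_I (2 * Real.pi * n * β * x)]
  push_cast
  ring_nf

/-- Invariance determines the nontrivial Fourier coefficients of `μ` on `[0, γ)`. -/
theorem setIntegral_exp_Ico [IsFiniteMeasure μ] (hirr : Irrational β)
    (h : IsCIUPM (T 0 β) μ) (hβγ : β * γ = 1) (hγ0 : 0 < γ) (hγ : γ < 1)
    (hμ : ∀ᵐ x ∂μ, x ∈ Ico (0 : ℝ) (1 + γ)) {n : ℤ} (hn : n ≠ 0) :
    ∫ x : ℝ in Ico 0 γ, Complex.exp (2 * Real.pi * Complex.I * n * β * x) ∂μ =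
      1 / (2 * Real.pi * Complex.I * n * β) := by
  set c : ℂ := 2 * Real.pi * Complex.I * n * β with hc
  have hβ0 : β ≠ 0 := left_ne_zero_of_mul_eq_one hβγ
  have hc0 : c ≠ 0 := by simp [hc, Real.pi_ne_zero, hn, hβ0]
  have hcγ : Complex.exp (c * γ) = 1 := by
    refine Complex.exp_eq_one_iff.2 ⟨n, ?_⟩
    have : (β : ℂ) * γ = 1 := by exact_mod_cast hβγ
    rw [hc]
    linear_combination 2 * Real.pi * Complex.I * n * this
  let f : ℝ → ℂ := fun x => Complex.exp (c * x)
  have hint (m : Measure ℝ) [IsFiniteMeasure m] : Integrable f m := integrable_exp_frequency m n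
  have htotal : ∫ x, f x ∂μ = 0 := integral_exp_eq_zero_of_map_fract h.2 hn
  have hsplit : ∫ x, f x ∂μ = (∫ x in Ico 0 γ, f x ∂μ) + (∫ x in Ico γ 1, f x ∂μ) +
      ∫ x in Ico 1 (1 + γ), f x ∂μ := by
    conv_lhs => rw [← Measure.restrict_eq_self_of_ae_mem hμ]
    rw [← setIntegral_union (Ico_disjoint_Ico_same) measurableSet_Ico (hint _) (hint _),
      Ico_union_Ico_eq_Ico hγ0.le hγ.le,
      ← setIntegral_union (Ico_disjoint_Ico_same) measurableSet_Ico (hint _) (hint _),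
      Ico_union_Ico_eq_Ico zero_le_one (by linarith)]
  have hmid : ∫ x in Ico γ 1, f x ∂μ = (Complex.exp c - 1) / c := by
    rw [restrict_Ico_eq_volume h.1 hγ0 hγ hμ, integral_Ico_eq_integral_Ioc,
      ← intervalIntegral.integral_of_le hγ.le, integral_exp_mul_complex hc0, hcγ]
    simp
  have hm : Measurable fun x : ℝ => x - 1 := measurable_id.sub_const 1
  have hright : ∫ x in Ico 1 (1 + γ), f x ∂μ = -(Complex.exp c * ∫ x in Ico 0 γ, f x ∂μ) := by
    have h0 : (∫ x in Ico 0 γ, f x ∂μ) +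
        ∫ x, f x ∂((μ.restrict (Ico 1 (1 + γ))).map fun x => x - 1) = 0 := by
      rw [← integral_add_measure (hint _) (hint _),
        restrict_add_map_restrict h.1 (hμ.mono fun x hx => ⟨hx.1, by linarith [hx.2]⟩) hγ.le,
        integral_Ico_eq_integral_Ioc, ← intervalIntegral.integral_of_le hγ0.le,
        integral_exp_mul_complex hc0, hcγ]
      simp
    rw [integral_map hm.aemeasurable (hint _).aestronglyMeasurable] at h0
    have h1 : ∫ x in Ico 1 (1 + γ), f x ∂μ =
        Complex.exp c * ∫ x in Ico 1 (1 + γ), f (x - 1) ∂μ := by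
      rw [← integral_const_mul]
      refine integral_congr_ae (.of_forall fun x => ?_)
      simp only [f]
      rw [← Complex.exp_add]
      push_cast
      ring_nf
    rw [h1]
    linear_combination Complex.exp c * h0
  have hne : 1 - Complex.exp c ≠ 0 := sub_ne_zero.2 (exp_frequency_ne_one hirr hn).symm
  rw [htotal, hmid, hright] at hsplit
  refine mul_left_cancel₀ hne ?_
  change _ * (∫ x in Ico 0 γ, f x ∂μ) = _
  linear_combination -hsplit

/-- `μ` agrees on `[0, γ)` with the ramp, up to a multiple of Lebesgue measure. -/
theorem restrict_add_smul_eq [IsFiniteMeasure μ] (hirr : Irrational β)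
    (h : IsCIUPM (T 0 β) μ) (hβγ : β * γ = 1) (hγ0 : 0 < γ) (hγ : γ < 1)
    (hμ : ∀ᵐ x ∂μ, x ∈ Ico (0 : ℝ) (1 + γ)) :
    μ.restrict (Ico 0 γ) + ENNReal.ofReal (1 / 2) • volume.restrict (Ico 0 γ) =
      rampMeasure β γ + ENNReal.ofReal (β * μ.real (Ico 0 γ)) • volume.restrict (Ico 0 γ) := by
  have hβ0 : 0 < β := pos_of_mul_pos_left (hβγ ▸ one_pos) hγ0.le
  have : IsFiniteMeasure (rampMeasure β γ) :=
    ⟨by rw [rampMeasure_univ hβ0 hγ0.le]; exact ENNReal.ofReal_lt_top⟩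
  have hvol (a : ℝ) : IsFiniteMeasure (ENNReal.ofReal a • volume.restrict (Ico 0 γ)) :=
    Measure.smul_finite _ ENNReal.ofReal_ne_top
  have := hvol (1 / 2)
  have := hvol (β * μ.real (Ico 0 γ))
  have hmem : ∀ᵐ x ∂volume.restrict (Ico 0 γ), x ∈ Ico 0 γ := ae_restrict_mem measurableSet_Ico
  refine measure_ext_of_integral_exp hγ0
    (ae_add_measure_iff.2 ⟨ae_restrict_mem measurableSet_Ico, Measure.ae_smul_measure hmem _⟩)
    (ae_add_measure_iff.2 ⟨ae_mem_rampMeasure, Measure.ae_smul_measure hmem _⟩) fun n => ?_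
  have hγβ : (γ : ℂ)⁻¹ = β := by
    rw [← Complex.ofReal_inv, inv_eq_of_mul_eq_one_left hβγ]
  have hfreq (x : ℝ) : 2 * Real.pi * Complex.I * n * x / γ =
      2 * Real.pi * Complex.I * n * β * x := by
    rw [div_eq_mul_inv, hγβ]
    ring
  simp only [hfreq]
  rw [integral_add_measure (integrable_exp_frequency _ n) (integrable_exp_frequency _ n),
    integral_add_measure (integrable_exp_frequency _ n) (integrable_exp_frequency _ n),
    integral_smul_measure, integral_smul_measure]
  have hβγ' : (β : ℂ) * γ = 1 := by exact_mod_cast hβγ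
  rcases eq_or_ne n 0 with rfl | hn
  · have hM : (rampMeasure β γ).real univ = 1 / 2 * γ := by
      rw [Measure.real, rampMeasure_univ hβ0 hγ0.le, ENNReal.toReal_ofReal (by positivity)]
      linear_combination γ / 2 * hβγ
    have hM0 : 0 ≤ β * μ.real (Ico 0 γ) := by positivity
    simp only [Int.cast_zero, mul_zero, zero_mul, Complex.exp_zero, integral_const, hM,
      ENNReal.toReal_ofReal hM0, ENNReal.toReal_ofReal (one_half_pos (α := ℝ)).le,
      measureReal_restrict_apply_univ, Real.volume_real_Ico_of_le hγ0.le, Complex.real_smul]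
    push_cast
    linear_combination -(μ.real (Ico 0 γ) : ℂ) * hβγ'
  · have hc : 2 * Real.pi * Complex.I * n * β ≠ 0 := by simp [Real.pi_ne_zero, hn, hβ0.ne']
    have hcγ : Complex.exp (2 * Real.pi * Complex.I * n * β * γ) = 1 :=
      Complex.exp_eq_one_iff.2 ⟨n, by linear_combination 2 * Real.pi * Complex.I * n * hβγ'⟩
    have hL : ∫ x in Ico 0 γ, Complex.exp (2 * Real.pi * Complex.I * n * β * x) = 0 := by
      rw [integral_Ico_eq_integral_Ioc, ← intervalIntegral.integral_of_le hγ0.le,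
        integral_exp_mul_complex hc, hcγ]
      simp
    rw [hL, setIntegral_exp_Ico hirr h hβγ hγ0 hγ hμ hn,
      integral_exp_rampMeasure hβ0 hγ0.le hc hcγ, hβγ']
    simp

theorem mul_measureReal_Ico_eq_half [IsFiniteMeasure μ] (hirr : Irrational β)
    (h : IsCIUPM (T 0 β) μ) (hβγ : β * γ = 1) (hγ0 : 0 < γ) (hγ : γ < 1)
    (hμ : ∀ᵐ x ∂μ, x ∈ Ico (0 : ℝ) (1 + γ)) : β * μ.real (Ico 0 γ) = 1 / 2 := by
  have hβ0 : 0 < β := pos_of_mul_pos_left (hβγ ▸ one_pos) hγ0.le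
  set M := β * μ.real (Ico 0 γ) with hM
  have hM0 : 0 ≤ M := by positivity
  have hIco {a b : ℝ} (ha : 0 ≤ a) (hab : a ≤ b) (hb : b ≤ γ) :
      μ.real (Ico a b) + 1 / 2 * (b - a) = β * (b ^ 2 - a ^ 2) / 2 + M * (b - a) := by
    have hsub : Ico a b ∩ Ico 0 γ = Ico a b := inter_eq_left.2 (Ico_subset_Ico ha hb)
    have hsq : 0 ≤ b ^ 2 - a ^ 2 := by nlinarith
    have := congrArg (fun m => (m (Ico a b)).toReal) (restrict_add_smul_eq hirr h hβγ hγ0 hγ hμ)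
    simp only [Measure.add_apply, Measure.smul_apply, smul_eq_mul,
      Measure.restrict_apply measurableSet_Ico, hsub, rampMeasure_Ico hβ0 ha hab hb,
      Real.volume_Ico, ← hM] at this
    rw [ENNReal.toReal_add (measure_ne_top _ _) (ENNReal.mul_ne_top (by simp) (by simp)),
      ENNReal.toReal_add (by simp) (ENNReal.mul_ne_top (by simp) (by simp)),
      ENNReal.toReal_mul, ENNReal.toReal_mul, ENNReal.toReal_ofReal (sub_nonneg.2 hab),
      ENNReal.toReal_ofReal hM0,
      ENNReal.toReal_ofReal (div_nonneg (mul_nonneg hβ0.le hsq) two_pos.le),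
      ENNReal.toReal_ofReal (by norm_num)] at this
    exact this
  have hle {a b : ℝ} (ha : 0 ≤ a) (hab : a ≤ b) (hb : b ≤ γ) : μ.real (Ico a b) ≤ b - a := by
    refine ENNReal.toReal_le_of_le_ofReal (sub_nonneg.2 hab) ?_
    rw [← Real.volume_Ico, ← measure_add_measure_shift h.1
      (hμ.mono fun x hx => ⟨hx.1, by linarith [hx.2]⟩) measurableSet_Ico
      (Ico_subset_Ico ha (hb.trans hγ.le))]
    exact le_self_add
  apply le_antisymm
  · by_contra! hlt
    obtain ⟨ε, hε, hεγ, hεM⟩ : ∃ ε, 0 < ε ∧ ε ≤ γ ∧ β * ε ≤ M - 1 / 2 :=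
      ⟨min γ ((M - 1 / 2) / β), lt_min hγ0 (div_pos (by linarith) hβ0), min_le_left _ _,
        (mul_le_mul_of_nonneg_left (min_le_right _ _) hβ0.le).trans_eq (by field_simp)⟩
    have h1 := hIco (sub_nonneg.2 hεγ) (sub_le_self γ hε.le) le_rfl
    have h2 := hle (sub_nonneg.2 hεγ) (sub_le_self γ hε.le) le_rfl
    have h3 : β * (γ ^ 2 - (γ - ε) ^ 2) / 2 = ε - β * ε ^ 2 / 2 := by
      linear_combination ε * hβγ
    have h4 : β * ε * ε ≤ (M - 1 / 2) * ε := mul_le_mul_of_nonneg_right hεM hε.le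
    have h5 : 0 < (M - 1 / 2) * ε := mul_pos (by linarith) hε
    nlinarith
  · by_contra! hlt
    obtain ⟨ε, hε, hεγ, hεM⟩ : ∃ ε, 0 < ε ∧ ε ≤ γ ∧ β * ε ≤ 1 / 2 - M :=
      ⟨min γ ((1 / 2 - M) / β), lt_min hγ0 (div_pos (by linarith) hβ0), min_le_left _ _,
        (mul_le_mul_of_nonneg_left (min_le_right _ _) hβ0.le).trans_eq (by field_simp)⟩
    have h1 := hIco le_rfl hε.le hεγ
    have h2 : 0 ≤ μ.real (Ico 0 ε) := measureReal_nonneg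
    have h4 : β * ε * ε ≤ (1 / 2 - M) * ε := mul_le_mul_of_nonneg_right hεM hε.le
    have h5 : 0 < (1 / 2 - M) * ε := mul_pos (by linarith) hε
    nlinarith

theorem restrict_Ico_eq_rampMeasure [IsFiniteMeasure μ] (hirr : Irrational β)
    (h : IsCIUPM (T 0 β) μ) (hβγ : β * γ = 1) (hγ0 : 0 < γ) (hγ : γ < 1)
    (hμ : ∀ᵐ x ∂μ, x ∈ Ico (0 : ℝ) (1 + γ)) : μ.restrict (Ico 0 γ) = rampMeasure β γ := by
  have key := restrict_add_smul_eq hirr h hβγ hγ0 hγ hμ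
  rw [mul_measureReal_Ico_eq_half hirr h hβγ hγ0 hγ hμ] at key
  ext A hA
  have hA' := congrArg (fun m => m A) key
  simp only [Measure.add_apply] at hA'
  refine (ENNReal.add_left_inj ?_).1 hA'
  rw [Measure.smul_apply, smul_eq_mul, Measure.restrict_apply hA]
  exact ENNReal.mul_ne_top ENNReal.ofReal_ne_top
    (measure_ne_top_of_subset inter_subset_right (by simp))

theorem measurable_rho : Measurable (rho β) := by
  unfold rho
  refine Measurable.ite measurableSet_Iio (by fun_prop) ?_
  refine Measurable.ite measurableSet_Iio (by fun_prop) ?_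
  refine Measurable.ite measurableSet_Iio (by fun_prop) ?_
  exact Measurable.ite measurableSet_Iic (by fun_prop) (by fun_prop)

theorem rho_of_mem_Ico_zero {x : ℝ} (hx : x ∈ Ico 0 (1 / β)) : rho β x = β * x := by
  rw [rho, if_neg hx.1.not_gt, if_pos hx.2]

theorem rho_of_mem_Ico_one {x : ℝ} (hβ : 0 < β) (hx : x ∈ Ico (1 / β) 1) : rho β x = 1 := by
  rw [rho, if_neg ((one_div_pos.2 hβ).le.trans hx.1).not_gt, if_neg hx.1.not_gt, if_pos hx.2]

theorem rho_add_one {x : ℝ} (hβ : 1 < β) (hx : x ∈ Ico 0 (1 / β)) : rho β (x + 1) = 1 - β * x := by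
  have h1 : 1 / β < 1 := (div_lt_one (by linarith)).2 hβ
  have := hx.1
  have := hx.2
  rw [rho, if_neg (by linarith), if_neg (by linarith), if_neg (by linarith), if_pos (by linarith)]
  ring

theorem rho_of_notMem {x : ℝ} (hβ : 1 < β) (hx : x ∉ Ico 0 (1 + 1 / β)) : rho β x = 0 := by
  have h1 : 1 / β < 1 := (div_lt_one (by linarith)).2 hβ
  rcases lt_or_ge x 0 with h0 | h0
  · rw [rho, if_pos h0]
  · have h2 : 1 + 1 / β ≤ x := not_lt.1 fun h => hx ⟨h0, h⟩
    have : 0 < 1 / β := one_div_pos.2 (by linarith)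
    rw [rho, if_neg h0.not_gt, if_neg (by linarith), if_neg (by linarith)]
    split_ifs with h3
    · rw [le_antisymm h3 h2]
      field_simp
      ring
    · rfl

/-- `μ` has density `rho` as soon as it is a ramp on `[0, 1 / β)`. -/
theorem eq_withDensity_rho [IsFiniteMeasure μ] (hβ : 1 < β)
    (h : μ.map Int.fract = volume.restrict (Ico (0 : ℝ) 1))
    (hμ : ∀ᵐ x ∂μ, x ∈ Ico (0 : ℝ) (1 + 1 / β))
    (hramp : μ.restrict (Ico 0 (1 / β)) = rampMeasure β (1 / β)) :
    μ = volume.withDensity fun t => ENNReal.ofReal (rho β t) := by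
  have hβ0 : 0 < β := by linarith
  have hγ0 : 0 < 1 / β := one_div_pos.2 hβ0
  have hγ : 1 / β < 1 := (div_lt_one hβ0).2 hβ
  set ν := volume.withDensity fun t => ENNReal.ofReal (rho β t) with hν
  have hρ : Measurable fun t => ENNReal.ofReal (rho β t) := measurable_rho.ennreal_ofReal
  have hνmem : ∀ᵐ x ∂ν, x ∈ Ico (0 : ℝ) (1 + 1 / β) := by
    rw [ae_withDensity_iff hρ]
    refine .of_forall fun x hx => ?_
    by_contra hx'
    exact hx (by rw [rho_of_notMem hβ hx', ENNReal.ofReal_zero])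
  have hleft : μ.restrict (Ico 0 (1 / β)) = ν.restrict (Ico 0 (1 / β)) := by
    rw [hramp, rampMeasure, hν, restrict_withDensity measurableSet_Ico]
    refine withDensity_congr_ae ?_
    filter_upwards [ae_restrict_mem measurableSet_Ico] with x hx
    rw [rho_of_mem_Ico_zero hx]
  have hmid : μ.restrict (Ico (1 / β) 1) = ν.restrict (Ico (1 / β) 1) := by
    rw [restrict_Ico_eq_volume h hγ0 hγ hμ, hν, restrict_withDensity measurableSet_Ico]
    conv_lhs => rw [← withDensity_one (μ := volume.restrict (Ico (1 / β) 1))]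
    refine withDensity_congr_ae ?_
    filter_upwards [ae_restrict_mem measurableSet_Ico] with x hx
    rw [rho_of_mem_Ico_one hβ0 hx]
    simp
  have hright : μ.restrict (Ico 1 (1 + 1 / β)) = ν.restrict (Ico 1 (1 + 1 / β)) := by
    ext A hA
    rw [Measure.restrict_apply hA, Measure.restrict_apply hA]
    have hm : Measurable fun x : ℝ => x + 1 := measurable_id.add_const 1
    set C := A ∩ Ico 1 (1 + 1 / β) with hC
    have hCm : MeasurableSet C := hA.inter measurableSet_Ico
    set B := (fun x : ℝ => x + 1) ⁻¹' C with hB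
    have hBm : MeasurableSet B := hm hCm
    have hBsub : B ⊆ Ico 0 (1 / β) := fun x hx => ⟨by linarith [hx.2.1], by linarith [hx.2.2]⟩
    have hBC : (fun x : ℝ => x - 1) ⁻¹' B = C := by
      ext x
      simp [hB]
    have hμB : μ B = ∫⁻ x in B, ENNReal.ofReal (β * x) := by
      rw [← inter_eq_left.2 hBsub, ← Measure.restrict_apply hBm, hramp, rampMeasure,
        withDensity_apply _ hBm, Measure.restrict_restrict hBm]
    have hνC : ν C = ∫⁻ x in B, ENNReal.ofReal (1 - β * x) := by
      rw [hν, withDensity_apply _ hCm,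
        ← (measurePreserving_add_right volume (1 : ℝ)).setLIntegral_comp_preimage hCm hρ]
      exact setLIntegral_congr_fun hBm fun x hx => by
        simp only [rho_add_one hβ (hBsub hx)]
    have hsum : μ B + ν C = volume B := by
      rw [hμB, hνC, ← lintegral_add_left (by fun_prop), ← setLIntegral_one]
      refine setLIntegral_congr_fun hBm fun x hx => ?_
      have h0 := (hBsub hx).1
      have h1 : β * x ≤ 1 := by
        have := (lt_div_iff₀ hβ0).1 (hBsub hx).2
        linarith
      rw [← ENNReal.ofReal_add (by positivity) (by linarith)]
      simp
    have hsum' := measure_add_measure_shift h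
      (hμ.mono fun x hx => ⟨hx.1, by linarith [hx.2]⟩) hBm
      (hBsub.trans (Ico_subset_Ico_right hγ.le))
    rw [hBC, ← hsum] at hsum'
    exact (ENNReal.add_right_inj (measure_ne_top _ _)).1 hsum'
  rw [← Measure.restrict_eq_self_of_ae_mem hμ, ← Measure.restrict_eq_self_of_ae_mem hνmem,
    ← Ico_union_Ico_eq_Ico zero_le_one (by linarith : (1 : ℝ) ≤ 1 + 1 / β),
    ← Ico_union_Ico_eq_Ico hγ0.le hγ.le]
  exact Measure.restrict_union_congr.2 ⟨Measure.restrict_union_congr.2 ⟨hleft, hmid⟩, hright⟩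

end Uniqueness

theorem stmt_15 (β : ℝ) (hβ : 1 < β) (hirr : Irrational β)
    (μ : Measure ℝ) [IsProbabilityMeasure μ] (h : IsCIUPM (T 0 β) μ)
    (hsupp : msupp μ ⊆ Icc (0 : ℝ) (1 + 1 / β))
    (hdiam : EMetric.diam (msupp μ) = ENNReal.ofReal (1 + 1 / β)) :
    μ = volume.withDensity (fun t => ENNReal.ofReal (rho β t)) ∧
      (∀ t ∈ Icc (0 : ℝ) (1 / β), μ (Iic t) = ENNReal.ofReal (β / 2 * t ^ 2)) ∧
      (∀ t ∈ Icc (1 / β) (1 : ℝ), μ (Iic t) = ENNReal.ofReal (t - 1 / (2 * β))) ∧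
      (∀ t ∈ Icc (1 : ℝ) (1 + 1 / β),
        μ (Iic t) = ENNReal.ofReal (-(β / 2) * (t - 1) ^ 2 + t - 1 / (2 * β))) := by
  have hβ0 : 0 < β := by linarith
  have hγ0 : 0 < 1 / β := one_div_pos.2 hβ0
  have hγ : 1 / β < 1 := (div_lt_one hβ0).2 hβ
  have hβγ : β * (1 / β) = 1 := mul_one_div_cancel hβ0.ne'
  have hatom := measure_singleton_of_map_fract h.1
  have hμ : ∀ᵐ x ∂μ, x ∈ Ico (0 : ℝ) (1 + 1 / β) := by
    filter_upwards [ae_mem_of_msupp_subset hsupp,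
      measure_eq_zero_iff_ae_notMem.1 (hatom (1 + 1 / β))]
      with x hx hne
    exact ⟨hx.1, lt_of_le_of_ne hx.2 hne⟩
  have hμ2 : ∀ᵐ x ∂μ, x ∈ Ico (0 : ℝ) 2 := hμ.mono fun x hx => ⟨hx.1, by linarith [hx.2]⟩
  have hramp := restrict_Ico_eq_rampMeasure hirr h hβγ hγ0 hγ hμ
  have hIic (t : ℝ) : μ (Iic t) = μ (Ico 0 t) := by
    refine measure_congr ?_
    filter_upwards [hμ, measure_eq_zero_iff_ae_notMem.1 (hatom t)] with x hx hne
    exact propext ⟨fun hxt => ⟨hx.1, lt_of_le_of_ne hxt hne⟩, fun hxt => hxt.2.le⟩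
  have hleft {t : ℝ} (ht : t ∈ Icc 0 (1 / β)) :
      μ (Ico 0 t) = ENNReal.ofReal (β / 2 * t ^ 2) := by
    rw [← inter_eq_left.2 (Ico_subset_Ico_right ht.2 : Ico 0 t ⊆ Ico 0 (1 / β)),
      ← Measure.restrict_apply measurableSet_Ico, hramp, rampMeasure_Ico hβ0 le_rfl ht.1 ht.2]
    ring_nf
  have hmid {t : ℝ} (ht : t ∈ Icc (1 / β) 1) :
      μ (Ico 0 t) = ENNReal.ofReal (t - 1 / (2 * β)) := by
    rw [← Ico_union_Ico_eq_Ico hγ0.le ht.1,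
      measure_union Ico_disjoint_Ico_same measurableSet_Ico, hleft ⟨hγ0.le, le_rfl⟩,
      ← inter_eq_left.2 (Ico_subset_Ico_right ht.2 : Ico (1 / β) t ⊆ Ico (1 / β) 1),
      ← Measure.restrict_apply measurableSet_Ico, restrict_Ico_eq_volume h.1 hγ0 hγ hμ,
      Measure.restrict_apply measurableSet_Ico, inter_eq_left.2 (Ico_subset_Ico_right ht.2),
      Real.volume_Ico, ← ENNReal.ofReal_add (by positivity) (sub_nonneg.2 ht.1)]
    congr 1
    field_simp
    ring
  refine ⟨eq_withDensity_rho hβ h.1 hμ hramp, fun t ht => hIic t ▸ hleft ht,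
    fun t ht => hIic t ▸ hmid ht, fun t ht => ?_⟩
  have hs : t - 1 ∈ Icc 0 (1 / β) := ⟨by linarith [ht.1], by linarith [ht.2]⟩
  have hβs : β * (t - 1) ≤ 1 := (mul_le_mul_of_nonneg_left hs.2 hβ0.le).trans_eq hβγ
  have hnn : 0 ≤ t - 1 - β / 2 * (t - 1) ^ 2 := by nlinarith [hs.1]
  have hright : μ (Ico 1 t) = ENNReal.ofReal (t - 1 - β / 2 * (t - 1) ^ 2) := by
    have hsum := measure_add_measure_shift h.1 hμ2 (measurableSet_Ico (a := 0) (b := t - 1))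
      (Ico_subset_Ico_right (hs.2.trans hγ.le))
    rw [preimage_sub_const_Ico, zero_add, sub_add_cancel, hleft hs, Real.volume_Ico] at hsum
    refine (ENNReal.add_right_inj ENNReal.ofReal_ne_top).1 (hsum.trans ?_)
    rw [← ENNReal.ofReal_add (by positivity) hnn]
    ring_nf
  have hone : 0 ≤ 1 - 1 / (2 * β) := by
    rw [sub_nonneg, div_le_one (by positivity)]
    linarith
  rw [hIic, ← Ico_union_Ico_eq_Ico zero_le_one ht.1,
    measure_union Ico_disjoint_Ico_same measurableSet_Ico, hmid ⟨hγ.le, le_rfl⟩, hright,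
    ← ENNReal.ofReal_add hone hnn]
  ring_nf
end
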